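/- arXiv:2309.02183 — 9 statements merged into one kernel-verified Lean document; each statement's English description precedes it below -/
import Mathlib

section
/- For every u ∈ [0,1], almost surely E[ Σ_{l=1}^L 1{T ≤ φ(z_l, X, u)}·1{Z = z_l} | σ(X,W) ] = u. (This is the system of conditional moment equations, equation (6) of the paper, satisfied by the causal quantile regression function φ in the instrumental variable quantile regression model.) -/
open MeasureTheory ProbabilityTheory

/-- For every `u ∈ [0,1]`, almost surely
`E[ Σ_{l=1}^L 1{T ≤ φ(z_l, X, u)}·1{Z = z_l} | σ(X,W) ] = u`:
the system of conditional moment equations satisfied by the causal quantile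
regression function `φ` in the IVQR model. -/
theorem conditional_moment_equations
    {Ω : Type*} [MeasurableSpace Ω] (P : Measure Ω) [IsProbabilityMeasure P]
    {L dZ dX : ℕ} {𝓦 : Type*} [MeasurableSpace 𝓦]
    (z : Fin L → (Fin dZ → ℝ)) (hz : Function.Injective z)
    (Z : Ω → Fin L) (hZ : Measurable Z)
    (X : Ω → (Fin dX → ℝ)) (hX : Measurable X)
    (W : Ω → 𝓦) (hW : Measurable W)
    (U : Ω → ℝ) (hU : Measurable U)
    (hUrange : ∀ ω, U ω ∈ Set.Icc (0 : ℝ) 1)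
    (hUdist : Measure.map U P = volume.restrict (Set.Icc (0 : ℝ) 1))
    (hUindep : IndepFun U (fun ω => (X ω, W ω)) P)
    (φ : Fin L → (Fin dX → ℝ) → ℝ → ℝ)
    (hφmeas : ∀ l, Measurable fun p : (Fin dX → ℝ) × ℝ => φ l p.1 p.2)
    (hφmono : ∀ l x, StrictMonoOn (φ l x) (Set.Icc (0 : ℝ) 1))
    (T : Ω → ℝ) (hT : T = fun ω => φ (Z ω) (X ω) (U ω)) :
    ∀ u ∈ Set.Icc (0 : ℝ) 1,
      P[(fun ω => ∑ l : Fin L, if T ω ≤ φ l (X ω) u ∧ Z ω = l then (1 : ℝ) else 0)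
          | MeasurableSpace.comap (fun ω => (X ω, W ω)) inferInstance]
        =ᵐ[P] fun _ => u := by
  intro u hu
  have hsum : (fun ω => ∑ l : Fin L, if T ω ≤ φ l (X ω) u ∧ Z ω = l then (1 : ℝ) else 0)
      = (U ⁻¹' Set.Iic u).indicator fun _ => (1 : ℝ) := by
    funext ω
    rw [Finset.sum_eq_single (Z ω) (fun l _ hl => if_neg fun h => hl h.2.symm) (by simp)]
    simp only [hT, and_true, (hφmono (Z ω) (X ω)).le_iff_le (hUrange ω) hu]
    by_cases h : U ω ≤ u <;> simp [Set.indicator, h]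
  have hprob : P.real (U ⁻¹' Set.Iic u) = u := by
    have hIcc : Set.Iic u ∩ Set.Icc (0 : ℝ) 1 = Set.Icc 0 u := by
      ext x
      simp only [Set.mem_inter_iff, Set.mem_Iic, Set.mem_Icc]
      exact ⟨fun h => ⟨h.2.1, h.1⟩, fun h => ⟨h.2, h.1, h.2.trans hu.2⟩⟩
    rw [Measure.real, ← Measure.map_apply hU measurableSet_Iic, hUdist,
      Measure.restrict_apply measurableSet_Iic, hIcc, Real.volume_Icc, sub_zero,
      ENNReal.toReal_ofReal hu.1]
  have hmeas : StronglyMeasurable[MeasurableSpace.comap U inferInstance]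
      ((U ⁻¹' Set.Iic u).indicator fun _ => (1 : ℝ)) :=
    stronglyMeasurable_const.indicator ⟨Set.Iic u, measurableSet_Iic, rfl⟩
  rw [hsum]
  refine (condExp_indep_eq hU.comap_le (hX.prodMk hW).comap_le hmeas
    ((IndepFun_iff_Indep _ _ _).1 hUindep)).trans (.of_eq ?_)
  funext _
  rw [integral_indicator_const _ (hU measurableSet_Iic), hprob, smul_eq_mul, mul_one]
end

section
/- The threshold ū equals the supremum of the set { u ∈ [0,1] : there exists (θ_1,…,θ_L) with θ_l ∈ [0, min(t̄, c_l)] for every l such that Σ_{l=1}^L F_{l,k}(θ_l) = u for every k = 1,…,L }. (This is the characterization of the identified quantile region ū^x in the proof of Theorem 1 of the paper.) -/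
open MeasureTheory

/-- Characterization of the identified quantile region: the threshold `ū` equals the
supremum of the set of `u ∈ [0,1]` for which the system of equations
`Σ_{l=1}^L F_{l,k}(θ_l) = u` (for `k = 1,…,L`) has a solution with
`θ_l ∈ [0, min(tbar, c_l)]` for every `l`. -/
theorem ubar_eq_sSup
    {L : ℕ} (hL : 0 < L) (tbar : ℝ) (ht : 0 < tbar)
    (φ : Fin L → ℝ → ℝ) (ψ : Fin L → ℝ → ℝ)
    (hφcont : ∀ l, ContinuousOn (φ l) (Set.Icc (0 : ℝ) 1))
    (hφmono : ∀ l, StrictMonoOn (φ l) (Set.Icc (0 : ℝ) 1))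
    (hφmaps : ∀ l, ∀ u ∈ Set.Icc (0 : ℝ) 1, φ l u ∈ Set.Icc 0 tbar)
    (hψmaps : ∀ l, ∀ t ∈ Set.Icc (0 : ℝ) tbar, ψ l t ∈ Set.Icc (0 : ℝ) 1)
    (hψφ : ∀ l, ∀ u ∈ Set.Icc (0 : ℝ) 1, ψ l (φ l u) = u)
    (hφψ : ∀ l, ∀ t ∈ Set.Icc (0 : ℝ) tbar, φ l (ψ l t) = t)
    (c : Fin L → Fin L → ENNReal)
    (m : Fin L → ℝ)
    (hm : ∀ l, m l = (min (ENNReal.ofReal tbar) (⨅ k, c l k)).toReal)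
    (ubar : ℝ) (hubar : ubar = ⨅ l, ψ l (m l))
    (F : Fin L → Fin L → ℝ → ℝ)
    (hsol : ∀ u ∈ Set.Icc (0 : ℝ) 1, ∀ k, ∑ l, F l k (φ l u) = u)
    (huniq : ∀ u ∈ Set.Icc (0 : ℝ) 1, ∀ θ θ' : Fin L → ℝ,
      (∀ l, 0 ≤ θ l) → (∀ l, 0 ≤ θ' l) →
      (∀ k, ∑ l, F l k (θ l) = u) → (∀ k, ∑ l, F l k (θ' l) = u) → θ = θ') :
    ubar = sSup {u : ℝ | u ∈ Set.Icc (0 : ℝ) 1 ∧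
      ∃ θ : Fin L → ℝ, (∀ l, θ l ∈ Set.Icc 0 (m l)) ∧ ∀ k, ∑ l, F l k (θ l) = u} := by
  have : Nonempty (Fin L) := ⟨⟨0, hL⟩⟩
  have hmem : ∀ l, m l ∈ Set.Icc 0 tbar := fun l => by
    rw [hm l]
    refine ⟨ENNReal.toReal_nonneg, ?_⟩
    exact ENNReal.toReal_le_of_le_ofReal ht.le (min_le_left _ _)
  have hle : ∀ l, ubar ≤ ψ l (m l) := fun l => by
    rw [hubar]
    exact ciInf_le (Set.finite_range _).bddBelow l
  have hubar_mem : ubar ∈ Set.Icc (0 : ℝ) 1 := by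
    refine ⟨?_, (hle ⟨0, hL⟩).trans (hψmaps _ _ (hmem _)).2⟩
    rw [hubar]
    exact le_ciInf fun l => (hψmaps l _ (hmem l)).1
  refine Eq.symm (IsGreatest.csSup_eq ⟨⟨hubar_mem, fun l => φ l ubar, fun l => ⟨?_, ?_⟩,
    hsol ubar hubar_mem⟩, ?_⟩)
  · exact (hφmaps l ubar hubar_mem).1
  · calc φ l ubar ≤ φ l (ψ l (m l)) :=
          (hφmono l).monotoneOn hubar_mem (hψmaps l _ (hmem l)) (hle l)
      _ = m l := hφψ l _ (hmem l)
  · rintro u ⟨hu, θ, hθ, hθsol⟩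
    have hθφ : θ = fun l => φ l u :=
      huniq u hu _ _ (fun l => (hθ l).1) (fun l => (hφmaps l u hu).1) hθsol (hsol u hu)
    rw [hubar]
    refine le_ciInf fun l => ?_
    rw [← (hφmono l).le_iff_le hu (hψmaps l _ (hmem l)), hφψ l _ (hmem l)]
    simpa [hθφ] using (hθ l).2
end

section
/- For every y ∈ ℝ, the Gâteaux derivative of the inversion operator exists and lim_{t→0} [ (f+t·h)^{-1}(y) − f^{-1}(y) ] / t = − h(f^{-1}(y)) / f'(f^{-1}(y)). (Lemma on the Gâteaux derivative of the operator that associates to a function its inverse.) -/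
open Filter Function

/-- A function on `ℝ` whose derivative is at least `m` expands distances by at least `m`. -/
theorem mul_sub_le_sub_of_le_hasDerivAt {f f' : ℝ → ℝ} {m : ℝ}
    (hf : ∀ x, HasDerivAt f (f' x) x) (hf'm : ∀ x, m ≤ f' x) {a b : ℝ} (hab : a ≤ b) :
    m * (b - a) ≤ f b - f a :=
  mul_sub_le_image_sub_of_le_deriv (fun x => (hf x).differentiableAt)
    (fun x => (hf x).deriv ▸ hf'm x) hab

/-- A bounded continuous perturbation of a function with derivative at least `m > 0` is
surjective. -/
theorem surjective_add_of_le_hasDerivAt {f f' g : ℝ → ℝ} {m : ℝ} (hm : 0 < m)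
    (hf : ∀ x, HasDerivAt f (f' x) x) (hf'm : ∀ x, m ≤ f' x) (hg : Continuous g) {C : ℝ}
    (hgC : ∀ x, |g x| ≤ C) : Surjective (fun x => f x + g x) := by
  have hcont : Continuous f := continuous_iff_continuousAt.2 fun x => (hf x).continuousAt
  refine (hcont.add hg).surjective ?_ ?_
  · refine tendsto_atTop_mono' _ ?_
      (tendsto_atTop_add_const_right _ (f 0 - C) (tendsto_id.const_mul_atTop hm))
    filter_upwards [eventually_ge_atTop 0] with x hx
    have h₁ := mul_sub_le_sub_of_le_hasDerivAt hf hf'm hx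
    have h₂ := (abs_le.1 (hgC x)).1
    simp only [id, Pi.add_apply, sub_zero] at *
    linarith
  · refine tendsto_atBot_mono' _ ?_
      (tendsto_atBot_add_const_right _ (f 0 + C) (tendsto_id.const_mul_atBot hm))
    filter_upwards [eventually_le_atBot 0] with x hx
    have h₁ := mul_sub_le_sub_of_le_hasDerivAt hf hf'm hx
    have h₂ := (abs_le.1 (hgC x)).2
    simp only [id, Pi.add_apply, zero_sub] at *
    linarith

/-- Gâteaux derivative of the inversion operator: for every `y`,
`lim_{t→0} [(f+t·h)⁻¹(y) − f⁻¹(y)]/t = −h(f⁻¹(y))/f'(f⁻¹(y))`. -/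
theorem gateaux_derivative_of_inverse
    (f f' h : ℝ → ℝ) (m : ℝ) (hm : 0 < m)
    (hf : ∀ x, HasDerivAt f (f' x) x)
    (hf'm : ∀ x, m ≤ f' x)
    (C : ℝ) (hbound : ∀ x, |h x| ≤ C)
    (K : NNReal) (hlip : LipschitzWith K h) :
    ∀ y : ℝ,
      Tendsto
        (fun t : ℝ =>
          (Function.invFun (fun x => f x + t * h x) y - Function.invFun f y) / t)
        (nhdsWithin 0 {0}ᶜ)
        (nhds (-(h (Function.invFun f y)) / f' (Function.invFun f y))) := by
  intro y
  have hsurj (t : ℝ) : Surjective (fun x => f x + t * h x) :=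
    surjective_add_of_le_hasDerivAt (C := |t| * C) hm hf hf'm
      (continuous_const.mul hlip.continuous) fun x => by
        rw [abs_mul]
        exact mul_le_mul_of_nonneg_left (hbound x) (abs_nonneg t)
  have hx₀ : f (invFun f y) = y := invFun_eq (by simpa using hsurj 0 y)
  have hx (t : ℝ) : f (invFun (fun x => f x + t * h x) y)
      + t * h (invFun (fun x => f x + t * h x) y) = y :=
    invFun_eq (f := fun x => f x + t * h x) (hsurj t y)
  generalize invFun f y = x₀ at *
  generalize hu : (fun t : ℝ => invFun (fun x => f x + t * h x) y) = u
  have hut (t : ℝ) : invFun (fun x => f x + t * h x) y = u t := congrFun hu t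
  simp only [hut] at hx ⊢
  have hdist (t : ℝ) : |u t - x₀| ≤ |t| * (C / m) := by
    have hth : |t * h (u t)| ≤ |t| * C := by
      rw [abs_mul]
      exact mul_le_mul_of_nonneg_left (hbound _) (abs_nonneg t)
    rw [← mul_div_assoc, le_div_iff₀ hm]
    have hxt := hx t
    obtain ⟨h₁, h₂⟩ := abs_le.1 hth
    rcases le_total x₀ (u t) with hle | hle
    · have := mul_sub_le_sub_of_le_hasDerivAt hf hf'm hle
      rw [abs_of_nonneg (sub_nonneg.2 hle)]
      linarith
    · have := mul_sub_le_sub_of_le_hasDerivAt hf hf'm hle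
      rw [abs_of_nonpos (sub_nonpos.2 hle)]
      linarith
  have hu₀ : Tendsto u (nhdsWithin 0 {0}ᶜ) (nhds x₀) := by
    refine Tendsto.mono_left ?_ nhdsWithin_le_nhds
    rw [tendsto_iff_norm_sub_tendsto_zero]
    refine squeeze_zero (fun t => norm_nonneg _) hdist ?_
    have : Continuous fun t : ℝ => |t| * (C / m) := by fun_prop
    simpa using this.tendsto 0
  have hslope : Tendsto (fun t => dslope f x₀ (u t)) (nhdsWithin 0 {0}ᶜ) (nhds (f' x₀)) := by
    have hc : ContinuousAt (dslope f x₀) x₀ :=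
      continuousAt_dslope_same.2 (hf x₀).differentiableAt
    have := hc.tendsto.comp hu₀
    rwa [dslope_same, (hf x₀).deriv] at this
  have hne : f' x₀ ≠ 0 := (hm.trans_le (hf'm x₀)).ne'
  refine (((hlip.continuous.tendsto x₀).comp hu₀).neg.div hslope hne).congr' ?_
  filter_upwards [hslope.eventually_ne hne, self_mem_nhdsWithin] with t hs ht
  have ht : t ≠ 0 := ht
  have hmul : (u t - x₀) * dslope f x₀ (u t) = f (u t) - f x₀ := sub_smul_dslope f x₀ (u t)
  change -h (u t) / dslope f x₀ (u t) = (u t - x₀) / t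
  rw [div_eq_div_iff hs ht, hmul]
  linarith [hx t]
end

section
/- For every y ∈ ℝ, writing x_0 = f^{-1}(y), lim_{t→0} [ ((f+t·h)^{-1})'(y) − (f^{-1})'(y) ] / t = [ h(x_0)·(f^{-1})'(y)·f''(x_0) − h'(x_0) ] / ( f'(x_0) )². (Lemma on the Gâteaux derivative of the operator that associates to a function the derivative of its inverse.) -/
open Filter Function

/-- A real function whose derivative is bounded below by a positive constant expands distances by
at least that constant. -/
theorem mul_abs_sub_le_abs_sub_of_le_deriv {φ φ' : ℝ → ℝ} {c : ℝ}
    (hφ : ∀ x, HasDerivAt φ (φ' x) x) (hc : ∀ x, c ≤ φ' x) (a b : ℝ) :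
    c * |a - b| ≤ |φ a - φ b| := by
  have hmono : ∀ u v, u ≤ v → c * (v - u) ≤ φ v - φ u := fun u v huv =>
    mul_sub_le_image_sub_of_le_deriv (fun x => (hφ x).differentiableAt)
      (fun x => (hφ x).deriv ▸ hc x) huv
  rcases le_total a b with hab | hab
  · rw [abs_sub_comm a b, abs_sub_comm (φ a), abs_of_nonneg (sub_nonneg.2 hab)]
    exact (hmono a b hab).trans (le_abs_self _)
  · rw [abs_of_nonneg (sub_nonneg.2 hab)]
    exact (hmono b a hab).trans (le_abs_self _)

theorem surjective_of_pos_le_deriv {φ φ' : ℝ → ℝ} {c : ℝ} (hc0 : 0 < c)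
    (hφ : ∀ x, HasDerivAt φ (φ' x) x) (hc : ∀ x, c ≤ φ' x) : Surjective φ := by
  have hmono : ∀ u v, u ≤ v → c * (v - u) ≤ φ v - φ u := fun u v huv =>
    mul_sub_le_image_sub_of_le_deriv (fun x => (hφ x).differentiableAt)
      (fun x => (hφ x).deriv ▸ hc x) huv
  have hcont : Continuous φ := continuous_iff_continuousAt.2 fun x => (hφ x).continuousAt
  refine hcont.surjective ?_ ?_
  · refine tendsto_atTop_mono' atTop ?_
      (tendsto_atTop_add_const_right atTop (φ 0) (tendsto_id.const_mul_atTop hc0))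
    filter_upwards [eventually_ge_atTop 0] with x hx
    have := hmono 0 x hx
    simp only [id]
    linarith
  · refine tendsto_atBot_mono' atBot ?_
      (tendsto_atBot_add_const_right atBot (φ 0) (tendsto_id.const_mul_atBot hc0))
    filter_upwards [eventually_le_atBot 0] with x hx
    have := hmono x 0 hx
    simp only [id]
    linarith

theorem hasDerivAt_invFun_of_pos_le_deriv {φ φ' : ℝ → ℝ} {c : ℝ} (hc0 : 0 < c)
    (hφ : ∀ x, HasDerivAt φ (φ' x) x) (hc : ∀ x, c ≤ φ' x) (y : ℝ) :
    HasDerivAt (invFun φ) (φ' (invFun φ y))⁻¹ y := by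
  have hinv : ∀ z, φ (invFun φ z) = z :=
    rightInverse_invFun (surjective_of_pos_le_deriv hc0 hφ hc)
  have hcont : ContinuousAt (invFun φ) y := by
    refine continuousAt_of_locally_lipschitz one_pos c⁻¹ fun z _ => ?_
    have := mul_abs_sub_le_abs_sub_of_le_deriv hφ hc (invFun φ z) (invFun φ y)
    rw [hinv, hinv] at this
    rw [Real.dist_eq, Real.dist_eq, inv_mul_eq_div, le_div_iff₀ hc0]
    linarith
  exact HasDerivAt.of_local_left_inverse hcont (hφ _) (hc0.trans_le (hc _)).ne'
    (Eventually.of_forall hinv)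

theorem hasDerivAt_zero_id_mul {k : ℝ → ℝ} (hk : ContinuousAt k 0) :
    HasDerivAt (fun t => t * k t) (k 0) 0 := by
  rw [hasDerivAt_iff_tendsto_slope_zero]
  refine (hk.tendsto.mono_left nhdsWithin_le_nhds).congr' ?_
  filter_upwards [self_mem_nhdsWithin] with t ht
  have ht' : t ≠ 0 := ht
  simp [ht']

/-- Gâteaux derivative of the operator mapping a function to the derivative of its
inverse: for every `y`, writing `x₀ = f⁻¹(y)`,
`lim_{t→0} [((f+t·h)⁻¹)'(y) − (f⁻¹)'(y)]/t
  = [h(x₀)·(f⁻¹)'(y)·f''(x₀) − h'(x₀)] / (f'(x₀))²`. -/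
theorem gateaux_derivative_of_derivative_of_inverse
    (f f' f'' h h' : ℝ → ℝ) (m : ℝ) (hm : 0 < m)
    (hf : ∀ x, HasDerivAt f (f' x) x)
    (hf' : ∀ x, HasDerivAt f' (f'' x) x)
    (hf'm : ∀ x, m ≤ f' x)
    (hh : ∀ x, HasDerivAt h (h' x) x)
    (hh'cont : Continuous h')
    (Ch Ch' : ℝ) (hhbound : ∀ x, |h x| ≤ Ch) (hh'bound : ∀ x, |h' x| ≤ Ch') :
    ∀ y : ℝ,
      Tendsto
        (fun t : ℝ =>
          (deriv (Function.invFun (fun x => f x + t * h x)) y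
            - deriv (Function.invFun f) y) / t)
        (nhdsWithin 0 {0}ᶜ)
        (nhds
          ((h (Function.invFun f y) * deriv (Function.invFun f) y
              * f'' (Function.invFun f y)
            - h' (Function.invFun f y)) / (f' (Function.invFun f y)) ^ 2)) := by
  intro y
  have hsmall : ∀ᶠ t : ℝ in nhds 0, ∀ x, m / 2 ≤ f' x + t * h' x := by
    have hlim : Tendsto (fun t : ℝ => |t| * Ch') (nhds 0) (nhds 0) := by
      have hc : Continuous fun t : ℝ => |t| * Ch' := by fun_prop
      simpa using hc.tendsto 0
    filter_upwards [hlim.eventually_lt_const (half_pos hm)] with t ht x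
    have h1 : |t * h' x| ≤ |t| * Ch' := by
      rw [abs_mul]
      exact mul_le_mul_of_nonneg_left (hh'bound x) (abs_nonneg t)
    linarith [neg_abs_le (t * h' x), hf'm x]
  have hF : ∀ t x, HasDerivAt (fun x => f x + t * h x) (f' x + t * h' x) x :=
    fun t x => (hf x).add ((hh x).const_mul t)
  set ξ : ℝ → ℝ := fun t => invFun (fun x => f x + t * h x) y with hξ
  have hξ0 : ξ 0 = invFun f y := by simp [hξ]
  have hfinv : ∀ z, f (invFun f z) = z :=
    rightInverse_invFun (surjective_of_pos_le_deriv hm hf hf'm)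
  have hfinj : Injective f := fun a b hab => by
    have := mul_abs_sub_le_abs_sub_of_le_deriv hf hf'm a b
    rw [hab, sub_self, abs_zero] at this
    exact sub_eq_zero.1 (abs_nonpos_iff.1 (nonpos_of_mul_nonpos_right this hm))
  have hξeq : ∀ᶠ t in nhds 0, f (ξ t) = y - t * h (ξ t) := by
    filter_upwards [hsmall] with t ht
    have := rightInverse_invFun (surjective_of_pos_le_deriv (half_pos hm) (hF t) ht) y
    exact eq_sub_of_add_eq this
  have hξinv : ξ =ᶠ[nhds 0] fun t => invFun f (y - t * h (ξ t)) := by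
    filter_upwards [hξeq] with t ht
    exact hfinj (by rw [hfinv, ht])
  have hg := hasDerivAt_invFun_of_pos_le_deriv hm hf hf'm y
  have hth : Tendsto (fun t => t * h (ξ t)) (nhds 0) (nhds 0) := by
    refine tendsto_id.zero_mul_isBoundedUnder_le ?_
    exact isBoundedUnder_of ⟨Ch, fun t => hhbound (ξ t)⟩
  have hξcont : ContinuousAt ξ 0 := by
    have h1 : Tendsto (fun t => y - t * h (ξ t)) (nhds 0) (nhds y) := by
      simpa using hth.const_sub y
    rw [ContinuousAt, hξ0]
    exact (hg.continuousAt.tendsto.comp h1).congr' hξinv.symm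
  have hξderiv : HasDerivAt ξ ((f' (ξ 0))⁻¹ * -h (ξ 0)) 0 := by
    have h1 : HasDerivAt (fun t => y - t * h (ξ t)) (-h (ξ 0)) 0 :=
      (hasDerivAt_zero_id_mul (k := fun t => h (ξ t))
        ((hh _).continuousAt.comp hξcont)).const_sub y
    refine HasDerivAt.congr_of_eventuallyEq ?_ hξinv
    refine HasDerivAt.comp (h₂ := invFun f) 0 ?_ h1
    simpa [hξ0] using hg
  have hpos : 0 < f' (ξ 0) := hm.trans_le (hf'm _)
  have hD : HasDerivAt (fun t => (f' (ξ t) + t * h' (ξ t))⁻¹)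
      (-(f'' (ξ 0) * ((f' (ξ 0))⁻¹ * -h (ξ 0)) + h' (ξ 0)) / (f' (ξ 0)) ^ 2) 0 := by
    have h1 := ((hf' (ξ 0)).comp 0 hξderiv).add
      (hasDerivAt_zero_id_mul (k := fun t => h' (ξ t)) (hh'cont.continuousAt.comp hξcont))
    have h2 := h1.inv (by simpa using hpos.ne')
    exact HasDerivAt.congr_deriv h2 (by simp)
  have hderiv : (fun t => deriv (invFun fun x => f x + t * h x) y) =ᶠ[nhds 0]
      fun t => (f' (ξ t) + t * h' (ξ t))⁻¹ := by
    filter_upwards [hsmall] with t ht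
    exact (hasDerivAt_invFun_of_pos_le_deriv (half_pos hm) (hF t) ht y).deriv
  have hlim := hasDerivAt_iff_tendsto_slope_zero.1 (hD.congr_of_eventuallyEq hderiv)
  rw [hg.deriv, ← hξ0]
  convert hlim using 2 with t
  · simp [hg.deriv, hξ0, div_eq_inv_mul]
  · ring
end

section
/- The joint subdistribution function of (Ũ, Δ) := (min(U_g,U_c), 1{U_g ≤ U_c}) is given by: P(Ũ ≤ u, Δ = 1) = 0 for u < 0; P(Ũ ≤ u, Δ = 1) = u for 0 ≤ u < Ū − τ; P(Ũ ≤ u, Δ = 1) = −u²/(2τ) + u·Ū/τ − (Ū − τ)²/(2τ) for Ū − τ ≤ u < Ū; and P(Ũ ≤ u, Δ = 1) = (Ū² − (Ū − τ)²)/(2τ) for u ≥ Ū. (Explicit subdistribution of the generated censored uniform variable in Appendix A.1 of the paper.) -/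
open MeasureTheory ProbabilityTheory

theorem volume_restrict_Icc_zero_one_Iic {t : ℝ} (ht : t ≤ 1) :
    (volume.restrict (Set.Icc (0 : ℝ) 1)) (Set.Iic t) = ENNReal.ofReal t := by
  rw [Measure.restrict_apply measurableSet_Iic]
  have : Set.Iic t ∩ Set.Icc (0 : ℝ) 1 = Set.Icc 0 t := by
    ext x
    simp only [Set.mem_inter_iff, Set.mem_Iic, Set.mem_Icc]
    constructor
    · rintro ⟨h1, h2, -⟩
      exact ⟨h2, h1⟩
    · rintro ⟨h1, h2⟩
      exact ⟨h2, h1, h2.trans ht⟩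
  rw [this, Real.volume_Icc, sub_zero]

theorem subdistribution_eq_intervalIntegral
    {Ω : Type*} [MeasurableSpace Ω] (P : Measure Ω) [IsProbabilityMeasure P]
    {τ b : ℝ} (hτ : 0 < τ) (hb : b ≤ 1)
    {X Y : Ω → ℝ} (hX : Measurable X) (hY : Measurable Y)
    (hXdist : Measure.map X P = volume.restrict (Set.Icc (0 : ℝ) 1))
    (hYdist : Measure.map Y P = (ENNReal.ofReal τ)⁻¹ • volume.restrict (Set.Icc (b - τ) b))
    (hindep : IndepFun X Y P) (u : ℝ) :
    (P {ω | min (X ω) (Y ω) ≤ u ∧ X ω ≤ Y ω}).toReal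
      = τ⁻¹ * ∫ c in (b - τ)..b, max (min u c) 0 := by
  have hprod : Measure.map (fun ω => (Y ω, X ω)) P
      = (Measure.map Y P).prod (Measure.map X P) :=
    (indepFun_iff_map_prod_eq_prod_map_map hY.aemeasurable hX.aemeasurable).1 hindep.symm
  have hS : MeasurableSet {p : ℝ × ℝ | p.2 ≤ min u p.1} :=
    measurableSet_le measurable_snd (measurable_const.min measurable_fst)
  have hset : {ω | min (X ω) (Y ω) ≤ u ∧ X ω ≤ Y ω}
      = (fun ω => (Y ω, X ω)) ⁻¹' {p : ℝ × ℝ | p.2 ≤ min u p.1} := by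
    ext ω
    simp only [Set.mem_ofPred_eq, Set.mem_preimage, le_min_iff]
    constructor
    · rintro ⟨h1, h2⟩
      exact ⟨by rwa [min_eq_left h2] at h1, h2⟩
    · rintro ⟨h1, h2⟩
      exact ⟨(min_le_left _ _).trans h1, h2⟩
  have := Measure.isProbabilityMeasure_map (μ := P) hX.aemeasurable
  rw [hset, ← Measure.map_apply (hY.prodMk hX) hS, hprod, Measure.prod_apply hS, hYdist,
    lintegral_smul_measure, smul_eq_mul, ENNReal.toReal_mul, ENNReal.toReal_inv,
    ENNReal.toReal_ofReal hτ.le, hXdist, intervalIntegral.integral_of_le (by linarith),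
    ← integral_Icc_eq_integral_Ioc, integral_eq_lintegral_of_nonneg_ae (f := fun c => max (min u c) 0)
      (Filter.Eventually.of_forall fun _ => le_max_right _ _)
      (Continuous.aestronglyMeasurable (by fun_prop))]
  congr 2
  refine setLIntegral_congr_fun measurableSet_Icc fun c hc => ?_
  refine (volume_restrict_Icc_zero_one_Iic ((min_le_right u c).trans (hc.2.trans hb))).trans ?_
  simp

/-- Explicit joint subdistribution function of `(Ũ, Δ) = (min(U_g,U_c), 1{U_g ≤ U_c})`
where `U_g` is uniform on `[0,1]`, `U_c` is uniform on `[Ū−τ, Ū]`, and they are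
independent. -/
theorem subdistribution_min_uniform_censored
    {Ω : Type*} [MeasurableSpace Ω] (P : Measure Ω) [IsProbabilityMeasure P]
    (τ Ubar : ℝ) (hτ : 0 < τ) (hτU : τ ≤ Ubar) (hU1 : Ubar < 1)
    (Ug Uc : Ω → ℝ) (hUg : Measurable Ug) (hUc : Measurable Uc)
    (hUgdist : Measure.map Ug P = volume.restrict (Set.Icc (0 : ℝ) 1))
    (hUcdist : Measure.map Uc P
      = (ENNReal.ofReal τ)⁻¹ • volume.restrict (Set.Icc (Ubar - τ) Ubar))
    (hindep : IndepFun Ug Uc P) :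
    ∀ u : ℝ,
      (u < 0 → (P {ω | min (Ug ω) (Uc ω) ≤ u ∧ Ug ω ≤ Uc ω}).toReal = 0) ∧
      (0 ≤ u → u < Ubar - τ →
        (P {ω | min (Ug ω) (Uc ω) ≤ u ∧ Ug ω ≤ Uc ω}).toReal = u) ∧
      (Ubar - τ ≤ u → u < Ubar →
        (P {ω | min (Ug ω) (Uc ω) ≤ u ∧ Ug ω ≤ Uc ω}).toReal
          = -(u ^ 2) / (2 * τ) + u * Ubar / τ - (Ubar - τ) ^ 2 / (2 * τ)) ∧
      (Ubar ≤ u →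
        (P {ω | min (Ug ω) (Uc ω) ≤ u ∧ Ug ω ≤ Uc ω}).toReal
          = (Ubar ^ 2 - (Ubar - τ) ^ 2) / (2 * τ)) := by
  intro u
  rw [subdistribution_eq_intervalIntegral P hτ hU1.le hUg hUc hUgdist hUcdist hindep u]
  have hle : Ubar - τ ≤ Ubar := by linarith
  have hbelow : ∀ a b : ℝ, 0 ≤ u → u ≤ a → a ≤ b →
      ∫ c in a..b, max (min u c) 0 = (b - a) * u := by
    intro a b hu hua hab
    rw [intervalIntegral.integral_congr (g := fun _ => u)]
    · simp
    · intro c hc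
      rw [Set.uIcc_of_le hab] at hc
      simp only [min_eq_left (hua.trans hc.1), max_eq_left hu]
  have habove : ∀ a b : ℝ, 0 ≤ a → a ≤ b → b ≤ u →
      ∫ c in a..b, max (min u c) 0 = (b ^ 2 - a ^ 2) / 2 := by
    intro a b ha hab hbu
    rw [intervalIntegral.integral_congr (g := fun c => c), integral_id]
    intro c hc
    rw [Set.uIcc_of_le hab] at hc
    simp only [min_eq_right (hc.2.trans hbu), max_eq_left (ha.trans hc.1)]
  refine ⟨fun hu => ?_, fun hu hu' => ?_, fun hu hu' => ?_, fun hu => ?_⟩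
  · have : ∀ c : ℝ, max (min u c) 0 = 0 := fun c =>
      max_eq_right ((min_le_left u c).trans hu.le)
    simp [this]
  · rw [hbelow _ _ hu hu'.le hle]
    field_simp
    ring
  · have hint : ∀ a b : ℝ, IntervalIntegrable (fun c => max (min u c) 0) volume a b :=
      fun a b => Continuous.intervalIntegrable (by fun_prop) a b
    rw [← intervalIntegral.integral_add_adjacent_intervals (hint _ u) (hint u _),
      habove _ _ (by linarith) hu le_rfl, hbelow _ _ (by linarith) le_rfl hu'.le]
    field_simp
    ring
  · rw [habove _ _ (by linarith) hle hu]
    field_simp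
end

section
/- For every y ∈ ℝ and every function G: ℝ → ℝ that is differentiable at the point f^{-1}(y), lim_{t→0} [ G((f+t·h)^{-1}(y)) − G(f^{-1}(y)) ] / t = − G'(f^{-1}(y)) · h(f^{-1}(y)) / f'(f^{-1}(y)). (Chain-rule form of the Gâteaux derivative of a perturbed inverse, used in step (2.3) of the proof of Theorem 5 of the paper to differentiate ε ↦ P(Ũ ≥ (φ+εϕ)^{-1}(t)).) -/
open Filter Function

/-- A continuous function that grows at least linearly, perturbed by a bounded continuous function,
is surjective. -/
theorem surjective_add_mul_of_bounded {f h : ℝ → ℝ} {m C : ℝ} (hm : 0 < m)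
    (hf : Continuous f) (hgrow : ∀ ⦃x z⦄, x ≤ z → m * (z - x) ≤ f z - f x)
    (hh : Continuous h) (hbound : ∀ x, |h x| ≤ C) (t : ℝ) :
    Surjective (fun x => f x + t * h x) := by
  have hth : ∀ x, |t * h x| ≤ |t| * C := fun x => by
    rw [abs_mul]
    exact mul_le_mul_of_nonneg_left (hbound x) (abs_nonneg t)
  refine Continuous.surjective (by fun_prop) ?_ ?_
  · have hlin : Tendsto (fun x : ℝ => m * x + (f 0 - |t| * C)) atTop atTop :=
      tendsto_atTop_add_const_right _ _ (tendsto_id.const_mul_atTop hm)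
    refine tendsto_atTop_mono' _ ?_ hlin
    filter_upwards [eventually_ge_atTop 0] with x hx
    linarith [hgrow hx, (abs_le.1 (hth x)).1]
  · have hlin : Tendsto (fun x : ℝ => m * x + (f 0 + |t| * C)) atBot atBot :=
      tendsto_atBot_add_const_right _ _ (tendsto_id.const_mul_atBot hm)
    refine tendsto_atBot_mono' _ ?_ hlin
    filter_upwards [eventually_le_atBot 0] with x hx
    linarith [hgrow hx, (abs_le.1 (hth x)).2]

/-- If `f` grows at least linearly, then it expands distances by the corresponding factor. -/
theorem mul_abs_sub_le_of_growth {f : ℝ → ℝ} {m : ℝ}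
    (hgrow : ∀ ⦃x z⦄, x ≤ z → m * (z - x) ≤ f z - f x) (x z : ℝ) :
    m * |z - x| ≤ |f z - f x| := by
  rcases le_total x z with hxz | hxz
  · rw [abs_of_nonneg (sub_nonneg.2 hxz)]
    exact (hgrow hxz).trans (le_abs_self _)
  · rw [abs_sub_comm z x, abs_sub_comm (f z), abs_of_nonneg (sub_nonneg.2 hxz)]
    exact (hgrow hxz).trans (le_abs_self _)

/-- A function dominated in distance by a continuous one at a point is continuous there. -/
theorem continuousAt_of_mul_abs_sub_le {u v : ℝ → ℝ} {m s : ℝ} (hm : 0 < m)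
    (hle : ∀ t, m * |u t - u s| ≤ |v t - v s|) (hv : ContinuousAt v s) : ContinuousAt u s := by
  have hlim : Tendsto (fun t => |v t - v s| / m) (nhds s) (nhds 0) := by
    have hcont : ContinuousAt (fun t => |v t - v s| / m) s :=
      (hv.sub continuousAt_const).abs.div_const m
    simpa [ContinuousAt] using hcont
  refine tendsto_iff_dist_tendsto_zero.2
    (squeeze_zero (fun _ => dist_nonneg) (fun t => ?_) hlim)
  rw [Real.dist_eq, le_div_iff₀ hm, mul_comm]
  exact hle t

/-- Chain-rule form of the Gâteaux derivative of a perturbed inverse: for every `y` and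
every `G` differentiable at `f⁻¹(y)`,
`lim_{t→0} [G((f+t·h)⁻¹(y)) − G(f⁻¹(y))]/t = −G'(f⁻¹(y))·h(f⁻¹(y))/f'(f⁻¹(y))`. -/
theorem gateaux_derivative_of_inverse_chain_rule
    (f f' h : ℝ → ℝ) (m : ℝ) (hm : 0 < m)
    (hf : ∀ x, HasDerivAt f (f' x) x)
    (hf'm : ∀ x, m ≤ f' x)
    (C : ℝ) (hbound : ∀ x, |h x| ≤ C)
    (K : NNReal) (hlip : LipschitzWith K h) :
    ∀ y : ℝ, ∀ G : ℝ → ℝ, DifferentiableAt ℝ G (Function.invFun f y) →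
      Tendsto
        (fun t : ℝ =>
          (G (Function.invFun (fun x => f x + t * h x) y)
            - G (Function.invFun f y)) / t)
        (nhdsWithin 0 {0}ᶜ)
        (nhds (-(deriv G (Function.invFun f y)) * h (Function.invFun f y)
          / f' (Function.invFun f y))) := by
  intro y G hG
  have hfc : Continuous f := continuous_iff_continuousAt.2 fun x => (hf x).continuousAt
  have hhc : Continuous h := hlip.continuous
  have hgrow : ∀ ⦃x z⦄, x ≤ z → m * (z - x) ≤ f z - f x :=
    mul_sub_le_image_sub_of_le_deriv (fun x => (hf x).differentiableAt)
      fun x => (hf x).deriv.symm ▸ hf'm x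
  have hexp := mul_abs_sub_le_of_growth hgrow
  have hsurj := surjective_add_mul_of_bounded hm hfc hgrow hhc hbound
  have hfsurj : Surjective f := by simpa using hsurj 0
  have hinj : Injective f := fun x z hxz => by
    have hle := hexp z x
    rw [hxz, sub_self, abs_zero] at hle
    have hzero : |x - z| ≤ 0 := by nlinarith
    exact sub_eq_zero.1 (abs_nonpos_iff.1 hzero)
  set g := invFun f with hg
  have hfg : ∀ z, f (g z) = z := rightInverse_invFun hfsurj
  set u : ℝ → ℝ := fun t => invFun (fun x => f x + t * h x) y with hu
  have hu0 : u 0 = g y := by simp [hu, hg]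
  have hfu : ∀ t, f (u t) = y - t * h (u t) := fun t =>
    eq_sub_of_add_eq (rightInverse_invFun (hsurj t) y)
  have hgc : ContinuousAt g y :=
    continuousAt_of_mul_abs_sub_le (v := id) hm
      (fun z => by simpa only [hfg, id] using hexp (g y) (g z)) continuousAt_id
  have huc : ContinuousAt u 0 := by
    refine continuousAt_of_mul_abs_sub_le (v := fun t => C * |t|) hm (fun t => ?_) (by fun_prop)
    refine (hexp (u 0) (u t)).trans ?_
    have hdiff : f (u t) - f (u 0) = -(t * h (u t)) := by rw [hfu, hfu]; ring
    rw [hdiff, abs_neg, abs_mul, mul_comm, abs_zero, mul_zero, sub_zero]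
    exact (mul_le_mul_of_nonneg_right (hbound _) (abs_nonneg t)).trans (le_abs_self _)
  have hfu' : HasDerivAt (fun t => f (u t)) (-h (g y)) 0 := by
    rw [hasDerivAt_iff_tendsto_slope]
    have hlim : Tendsto (fun t => -h (u t)) (nhdsWithin 0 {0}ᶜ) (nhds (-h (g y))) := by
      rw [← hu0]
      exact ((hhc.continuousAt.comp huc).neg).tendsto.mono_left nhdsWithin_le_nhds
    refine hlim.congr' ?_
    filter_upwards [self_mem_nhdsWithin] with t ht
    have ht0 : t ≠ 0 := ht
    rw [slope_def_field, hfu, hfu]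
    field_simp
    ring
  have hgd : HasDerivAt g (f' (g y))⁻¹ y :=
    HasDerivAt.of_local_left_inverse hgc (hf (g y)) (hm.trans_le (hf'm _)).ne'
      (Eventually.of_forall hfg)
  have hud : HasDerivAt u ((f' (g y))⁻¹ * -h (g y)) 0 := by
    have hcomp : HasDerivAt (g ∘ fun t => f (u t)) ((f' (g y))⁻¹ * -h (g y)) 0 := by
      refine HasDerivAt.comp 0 ?_ hfu'
      rwa [hu0, hfg]
    exact hcomp.congr_of_eventuallyEq
      (Eventually.of_forall fun t => (leftInverse_invFun hinj (u t)).symm)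
  have hGu : HasDerivAt (G ∘ u) (deriv G (g y) * ((f' (g y))⁻¹ * -h (g y))) 0 := by
    refine HasDerivAt.comp 0 ?_ hud
    rw [hu0]
    exact hG.hasDerivAt
  have hslope := hasDerivAt_iff_tendsto_slope.1 hGu
  have hval : -(deriv G (g y)) * h (g y) / f' (g y)
      = deriv G (g y) * ((f' (g y))⁻¹ * -h (g y)) := by
    rw [div_eq_mul_inv]; ring
  rw [hval]
  refine hslope.congr fun t => ?_
  rw [slope_def_field, comp_apply, comp_apply, hu0, sub_zero]
end

section
/- There exist δ > 0 and C ≥ 0 such that for every y ∈ ℝ and every t with 0 < |t| ≤ δ, | (f+t·h)^{-1}(y) − f^{-1}(y) + t·h(f^{-1}(y)) / f'(f^{-1}(y)) | ≤ C·t², i.e. the first-order expansion (f+t·h)^{-1}(y) = f^{-1}(y) − t·h(f^{-1}(y))·(f^{-1})'(y) + O(t²) holds uniformly in y. (Quantitative expansion established in the proofs of the Gâteaux-derivative lemmas of the paper.) -/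
open Function

lemma exists_hasDerivAt_sub_eq_mul {f f' : ℝ → ℝ} (hf : ∀ x, HasDerivAt f (f' x) x) (a b : ℝ) :
    ∃ c, |c - a| ≤ |b - a| ∧ f b - f a = f' c * (b - a) := by
  have hc : Continuous f := continuous_iff_continuousAt.2 fun x => (hf x).continuousAt
  rcases lt_trichotomy a b with hab | rfl | hab
  · obtain ⟨c, hc, h⟩ := exists_hasDerivAt_eq_slope f f' hab hc.continuousOn fun x _ => hf x
    refine ⟨c, ?_, ?_⟩
    · rw [abs_of_pos (sub_pos.2 hc.1), abs_of_pos (sub_pos.2 hab)]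
      linarith [hc.2]
    · rw [h, div_mul_cancel₀ _ (sub_ne_zero.2 hab.ne')]
  · exact ⟨a, le_rfl, by simp⟩
  · obtain ⟨c, hc, h⟩ := exists_hasDerivAt_eq_slope f f' hab hc.continuousOn fun x _ => hf x
    refine ⟨c, ?_, ?_⟩
    · rw [abs_of_neg (sub_neg.2 hc.2), abs_of_neg (sub_neg.2 hab)]
      linarith [hc.1]
    · have := sub_ne_zero.2 hab.ne'
      rw [h]
      field_simp
      ring

lemma mul_abs_sub_le_abs_sub_of_le_deriv_s14 {f f' : ℝ → ℝ} {m : ℝ}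
    (hf : ∀ x, HasDerivAt f (f' x) x) (hm : ∀ x, m ≤ f' x) (a b : ℝ) :
    m * |b - a| ≤ |f b - f a| := by
  obtain ⟨c, -, h⟩ := exists_hasDerivAt_sub_eq_mul hf a b
  rw [h, abs_mul]
  exact mul_le_mul_of_nonneg_right ((hm c).trans (le_abs_self _)) (abs_nonneg _)

lemma abs_sub_sub_deriv_mul_le {f f' f'' : ℝ → ℝ} {M : ℝ}
    (hf : ∀ x, HasDerivAt f (f' x) x) (hf' : ∀ x, HasDerivAt f' (f'' x) x)
    (hM : ∀ x, |f'' x| ≤ M) (a b : ℝ) :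
    |f b - f a - f' a * (b - a)| ≤ M * |b - a| ^ 2 := by
  obtain ⟨c, hca, h⟩ := exists_hasDerivAt_sub_eq_mul hf a b
  obtain ⟨d, -, h'⟩ := exists_hasDerivAt_sub_eq_mul hf' a c
  have hM0 : 0 ≤ M := (abs_nonneg _).trans (hM 0)
  calc |f b - f a - f' a * (b - a)| = |f'' d| * |c - a| * |b - a| := by
        rw [h, ← sub_mul, h', abs_mul, abs_mul]
    _ ≤ M * |b - a| * |b - a| := by gcongr; exact hM d
    _ = M * |b - a| ^ 2 := by ring

lemma surjective_add_of_le_deriv_of_bounded {f f' g : ℝ → ℝ} {m B : ℝ} (hm : 0 < m)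
    (hf : ∀ x, HasDerivAt f (f' x) x) (hf'm : ∀ x, m ≤ f' x)
    (hg : Continuous g) (hB : ∀ x, |g x| ≤ B) : Surjective fun x => f x + g x := by
  intro y
  have hc : Continuous f := continuous_iff_continuousAt.2 fun x => (hf x).continuousAt
  have hB0 : 0 ≤ B := (abs_nonneg _).trans (hB 0)
  obtain ⟨R, hR, hmR⟩ : ∃ R, 0 ≤ R ∧ m * R = |y| + |f 0| + B :=
    ⟨(|y| + |f 0| + B) / m, by positivity, by field_simp⟩
  refine mem_range_of_exists_le_of_exists_ge (hc.add hg) ⟨-R, ?_⟩ ⟨R, ?_⟩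
  · obtain ⟨c, -, h⟩ := exists_hasDerivAt_sub_eq_mul hf 0 (-R)
    have := mul_le_mul_of_nonneg_right (hf'm c) hR
    linarith [neg_abs_le y, le_abs_self (f 0), le_abs_self (g (-R)), hB (-R)]
  · obtain ⟨c, -, h⟩ := exists_hasDerivAt_sub_eq_mul hf 0 R
    have := mul_le_mul_of_nonneg_right (hf'm c) hR
    linarith [le_abs_self y, neg_abs_le (f 0), neg_abs_le (g R), hB R]

/-- Uniform first-order expansion of the perturbed inverse: there exist `δ > 0` and
`C ≥ 0` such that for all `y` and all `t` with `0 < |t| ≤ δ`,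
`|(f+t·h)⁻¹(y) − f⁻¹(y) + t·h(f⁻¹(y))/f'(f⁻¹(y))| ≤ C·t²`. -/
theorem inverse_first_order_expansion_uniform
    (f f' f'' h : ℝ → ℝ) (m M : ℝ) (hm : 0 < m) (hM : 0 ≤ M)
    (hf : ∀ x, HasDerivAt f (f' x) x)
    (hf' : ∀ x, HasDerivAt f' (f'' x) x)
    (hf'm : ∀ x, m ≤ f' x)
    (hf''M : ∀ x, |f'' x| ≤ M)
    (Ch : ℝ) (hbound : ∀ x, |h x| ≤ Ch)
    (K : NNReal) (hlip : LipschitzWith K h) :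
    ∃ δ > (0 : ℝ), ∃ C : ℝ, 0 ≤ C ∧
      ∀ y t : ℝ, 0 < |t| → |t| ≤ δ →
        |Function.invFun (fun x => f x + t * h x) y - Function.invFun f y
          + t * h (Function.invFun f y) / f' (Function.invFun f y)| ≤ C * t ^ 2 := by
  have hCh : 0 ≤ Ch := (abs_nonneg _).trans (hbound 0)
  refine ⟨1, one_pos, (M * (Ch / m) ^ 2 + K * (Ch / m)) / m, by positivity, fun y t _ _ => ?_⟩
  have hsurj : Surjective f := by
    simpa using surjective_add_of_le_deriv_of_bounded (g := fun _ => 0) (B := 0) hm hf hf'm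
      continuous_const (by simp)
  have hsurj_t : Surjective fun x => f x + t * h x := by
    refine surjective_add_of_le_deriv_of_bounded (B := |t| * Ch) hm hf hf'm
      (continuous_const.mul hlip.continuous) fun x => ?_
    rw [abs_mul]
    exact mul_le_mul_of_nonneg_left (hbound x) (abs_nonneg t)
  have ha : f (invFun f y) = y := invFun_eq (hsurj y)
  have hb : f (invFun (fun x => f x + t * h x) y) + t * h (invFun (fun x => f x + t * h x) y) = y :=
    invFun_eq (f := fun x => f x + t * h x) (hsurj_t y)
  generalize invFun (fun x => f x + t * h x) y = b at hb ⊢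
  generalize invFun f y = a at ha ⊢
  have hfa : 0 < f' a := hm.trans_le (hf'm a)
  have hdist : |b - a| ≤ |t| * (Ch / m) := by
    rw [← mul_div_assoc, le_div_iff₀ hm, mul_comm]
    calc m * |b - a| ≤ |f b - f a| := mul_abs_sub_le_abs_sub_of_le_deriv_s14 hf hf'm a b
      _ = |t| * |h b| := by
        rw [← abs_mul, ← abs_neg (t * h b)]
        congr 1
        linarith
      _ ≤ |t| * Ch := by gcongr; exact hbound b
  have hh : |h b - h a| ≤ K * |b - a| := by simpa [Real.dist_eq] using hlip.dist_le_mul b a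
  have hnum : |f' a * (b - a) + t * h a| ≤ (M * (Ch / m) ^ 2 + K * (Ch / m)) * t ^ 2 :=
    calc |f' a * (b - a) + t * h a|
        = |(f b - f a - f' a * (b - a)) + t * (h b - h a)| := by
          rw [← abs_neg]
          congr 1
          linarith
      _ ≤ |f b - f a - f' a * (b - a)| + |t| * |h b - h a| := by
          rw [← abs_mul]
          exact abs_add_le _ _
      _ ≤ M * |b - a| ^ 2 + |t| * (K * |b - a|) := by
          gcongr
          exact abs_sub_sub_deriv_mul_le hf hf' hf''M a b
      _ ≤ M * (|t| * (Ch / m)) ^ 2 + |t| * (K * (|t| * (Ch / m))) := by gcongr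
      _ = (M * (Ch / m) ^ 2 + K * (Ch / m)) * t ^ 2 := by
          rw [← sq_abs t]
          ring
  calc |b - a + t * h a / f' a| = |f' a * (b - a) + t * h a| / f' a := by
        rw [← abs_of_pos hfa, ← abs_div, abs_of_pos hfa]
        congr 1
        field_simp
    _ ≤ (M * (Ch / m) ^ 2 + K * (Ch / m)) * t ^ 2 / m :=
        div_le_div₀ (by positivity) hnum hm (hf'm a)
    _ = (M * (Ch / m) ^ 2 + K * (Ch / m)) / m * t ^ 2 := by ring
end

section
/- The function K is continuously differentiable on ℝ, vanishes outside [−1,1], and satisfies: ∫_ℝ K(u) du = 1; ∫_ℝ u^j K(u) du = 0 for j = 1, 2, 3; ∫_ℝ K(u)² du < ∞; and K, K' and K'' all vanish at the boundary points u = −1 and u = 1. (This verifies that the explicit kernel constructed in the paper satisfies its Assumption 4(ii) with ν = 4 and π = 3.) -/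
open MeasureTheory

/-- `K̄(x) = (693/512)·(1 − x²)⁵` on `[−1,1]`, and `0` outside. -/
noncomputable def Kbar (x : ℝ) : ℝ :=
  if |x| ≤ 1 then (693 / 512) * (1 - x ^ 2) ^ 5 else 0

/-- `K̄'(x) = −(693/512)·10·x·(1 − x²)⁴` on `[−1,1]`, and `0` outside. -/
noncomputable def Kbar' (x : ℝ) : ℝ :=
  if |x| ≤ 1 then -(693 / 512) * 10 * x * (1 - x ^ 2) ^ 4 else 0

/-- The kernel `K(x) = (3/2)·K̄(x) + (1/2)·x·K̄'(x)`. -/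
noncomputable def Kker (x : ℝ) : ℝ :=
  (3 / 2) * Kbar x + (1 / 2) * x * Kbar' x

open Set Filter Topology Asymptotics in
/-- The indicator of `s` times a differentiable function that vanishes to first order on the
frontier of `s` is differentiable everywhere. -/
theorem hasDerivAt_indicator_of_frontier {s : Set ℝ} {f f' : ℝ → ℝ}
    (hf : ∀ x, HasDerivAt f (f' x) x) (h0 : ∀ x ∈ frontier s, f x = 0)
    (h1 : ∀ x ∈ frontier s, f' x = 0) (x : ℝ) :
    HasDerivAt (s.indicator f) (s.indicator f' x) x := by
  by_cases hfr : x ∈ frontier s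
  · have hd : s.indicator f' x = 0 := by
      by_cases hx : x ∈ s <;> simp [hx, h1 x hfr]
    have hv : s.indicator f x = 0 := by
      by_cases hx : x ∈ s <;> simp [hx, h0 x hfr]
    have h := hf x
    rw [h1 x hfr, hasDerivAt_iff_isLittleO] at h
    rw [hd, hasDerivAt_iff_isLittleO]
    simp only [h0 x hfr, hv, smul_zero, sub_zero] at h ⊢
    exact (isBigO_of_le _ fun y => norm_indicator_le_norm_self f y).trans_isLittleO h
  by_cases hx : x ∈ s
  · have hi : s ∈ 𝓝 x := by
      by_contra hs
      exact hfr ⟨subset_closure hx, fun hi => hs (mem_interior_iff_mem_nhds.1 hi)⟩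
    rw [indicator_of_mem hx]
    refine (hf x).congr_of_eventuallyEq ?_
    filter_upwards [hi] with y hy using indicator_of_mem hy f
  · have hi : sᶜ ∈ 𝓝 x := by
      by_contra hs
      rw [← frontier_compl] at hfr
      exact hfr ⟨subset_closure hx, fun hi => hs (mem_interior_iff_mem_nhds.1 hi)⟩
    rw [indicator_of_notMem hx]
    refine (hasDerivAt_const x (0 : ℝ)).congr_of_eventuallyEq ?_
    filter_upwards [hi] with y hy using indicator_of_notMem hy f

/-- The polynomial that `Kker` agrees with on `[-1, 1]`. -/
noncomputable def kerPoly (x : ℝ) : ℝ :=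
  693 / 1024 * ((1 - x ^ 2) ^ 4 * (3 - 13 * x ^ 2))

/-- The derivative of `kerPoly`. -/
noncomputable def kerPolyDeriv (x : ℝ) : ℝ :=
  693 / 1024 * ((1 - x ^ 2) ^ 3 * (130 * x ^ 3 - 50 * x))

/-- The second derivative of `kerPoly`. -/
noncomputable def kerPolyDeriv₂ (x : ℝ) : ℝ :=
  693 / 1024 * ((1 - x ^ 2) ^ 2 * (-1170 * x ^ 4 + 740 * x ^ 2 - 50))

theorem hasDerivAt_one_sub_sq_pow (n : ℕ) (x : ℝ) :
    HasDerivAt (fun y : ℝ => (1 - y ^ 2) ^ n) (n * (1 - x ^ 2) ^ (n - 1) * (-(2 * x))) x := by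
  exact (((hasDerivAt_pow 2 x).const_sub 1).fun_pow n).congr_deriv (by simp)

theorem hasDerivAt_kerPoly (x : ℝ) : HasDerivAt kerPoly (kerPolyDeriv x) x := by
  have h := ((hasDerivAt_one_sub_sq_pow 4 x).fun_mul
    (((hasDerivAt_pow 2 x).const_mul 13).const_sub 3)).const_mul (693 / 1024)
  refine h.congr_deriv ?_
  simp only [kerPolyDeriv]
  push_cast
  ring

theorem hasDerivAt_kerPolyDeriv (x : ℝ) : HasDerivAt kerPolyDeriv (kerPolyDeriv₂ x) x := by
  have h := ((hasDerivAt_one_sub_sq_pow 3 x).fun_mul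
    (((hasDerivAt_pow 3 x).const_mul 130).fun_sub ((hasDerivAt_id x).const_mul 50))).const_mul
    (693 / 1024)
  refine h.congr_deriv ?_
  simp only [kerPolyDeriv₂, id]
  push_cast
  ring

theorem continuous_kerPoly : Continuous kerPoly := by
  unfold kerPoly
  fun_prop

theorem Kker_eq_indicator : Kker = (Set.Icc (-1) 1).indicator kerPoly := by
  funext x
  by_cases hx : |x| ≤ 1
  · rw [Set.indicator_of_mem (Set.mem_Icc.2 (abs_le.1 hx))]
    simp only [Kker, Kbar, Kbar', kerPoly, if_pos hx]
    ring
  · rw [Set.indicator_of_notMem (fun h => hx (abs_le.2 (Set.mem_Icc.1 h)))]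
    simp [Kker, Kbar, Kbar', hx]

theorem eq_neg_one_or_one_of_mem_frontier {x : ℝ} (hx : x ∈ frontier (Set.Icc (-1 : ℝ) 1)) :
    x = -1 ∨ x = 1 := by
  simpa [frontier_Icc (show (-1 : ℝ) ≤ 1 by norm_num)] using hx

theorem hasDerivAt_Kker (x : ℝ) :
    HasDerivAt Kker ((Set.Icc (-1) 1).indicator kerPolyDeriv x) x := by
  rw [Kker_eq_indicator]
  refine hasDerivAt_indicator_of_frontier hasDerivAt_kerPoly (fun y hy => ?_) (fun y hy => ?_) x <;>
    rcases eq_neg_one_or_one_of_mem_frontier hy with rfl | rfl <;>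
    norm_num [kerPoly, kerPolyDeriv]

theorem deriv_Kker : deriv Kker = (Set.Icc (-1) 1).indicator kerPolyDeriv :=
  funext fun x => (hasDerivAt_Kker x).deriv

theorem hasDerivAt_deriv_Kker (x : ℝ) :
    HasDerivAt (deriv Kker) ((Set.Icc (-1) 1).indicator kerPolyDeriv₂ x) x := by
  rw [deriv_Kker]
  refine hasDerivAt_indicator_of_frontier hasDerivAt_kerPolyDeriv (fun y hy => ?_)
    (fun y hy => ?_) x <;>
    rcases eq_neg_one_or_one_of_mem_frontier hy with rfl | rfl <;>
    norm_num [kerPolyDeriv, kerPolyDeriv₂]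

theorem contDiff_one_Kker : ContDiff ℝ 1 Kker :=
  contDiff_one_iff_deriv.2 ⟨fun x => (hasDerivAt_Kker x).differentiableAt,
    continuous_iff_continuousAt.2 fun x => (hasDerivAt_deriv_Kker x).continuousAt⟩

theorem Kker_neg (x : ℝ) : Kker (-x) = Kker x := by
  simp [Kker, Kbar, Kbar']

theorem integral_pow_mul_Kker (j : ℕ) :
    (∫ u, u ^ j * Kker u) = ∫ u in (-1 : ℝ)..1, u ^ j * kerPoly u := by
  rw [intervalIntegral.integral_of_le (by norm_num), ← integral_Icc_eq_integral_Ioc,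
    ← integral_indicator measurableSet_Icc, Kker_eq_indicator]
  simp only [Set.indicator_mul_right]

theorem integral_odd_pow_mul_Kker {j : ℕ} (hj : Odd j) : (∫ u, u ^ j * Kker u) = 0 := by
  have h := integral_neg_eq_self (fun u : ℝ => u ^ j * Kker u) volume
  simp only [Kker_neg, hj.neg_pow, neg_mul, integral_neg] at h
  linarith

theorem integral_sq_mul_Kker : (∫ u, u ^ 2 * Kker u) = 0 := by
  rw [integral_pow_mul_Kker, intervalIntegral.integral_eq_sub_of_hasDerivAt
    (f := fun u => 693 / 1024 * (u ^ 3 * (1 - u ^ 2) ^ 5))]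
  · norm_num
  · intro x _
    refine (((hasDerivAt_pow 3 x).fun_mul (hasDerivAt_one_sub_sq_pow 5 x)).const_mul
      (693 / 1024)).congr_deriv ?_
    simp only [kerPoly]
    push_cast
    ring
  · exact ((continuous_pow 2).mul continuous_kerPoly).intervalIntegrable _ _

theorem integral_Kker : (∫ u, Kker u) = 1 := by
  have h := integral_pow_mul_Kker 0
  simp only [pow_zero, one_mul] at h
  rw [h, intervalIntegral.integral_eq_sub_of_hasDerivAt
    (f := fun u => 693 / 1024 * (3 * u - 25 / 3 * u ^ 3 + 14 * u ^ 5 - 90 / 7 * u ^ 7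
      + 55 / 9 * u ^ 9 - 13 / 11 * u ^ 11))]
  · norm_num
  · intro x _
    refine ((((((((hasDerivAt_id x).const_mul 3).fun_sub
      ((hasDerivAt_pow 3 x).const_mul (25 / 3))).fun_add
      ((hasDerivAt_pow 5 x).const_mul 14)).fun_sub
      ((hasDerivAt_pow 7 x).const_mul (90 / 7))).fun_add
      ((hasDerivAt_pow 9 x).const_mul (55 / 9))).fun_sub
      ((hasDerivAt_pow 11 x).const_mul (13 / 11))).const_mul (693 / 1024)).congr_deriv ?_
    simp only [kerPoly]
    push_cast
    ring
  · exact continuous_kerPoly.intervalIntegrable _ _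

theorem Kker_eq_zero_of_notMem {x : ℝ} (hx : x ∉ Set.Icc (-1 : ℝ) 1) : Kker x = 0 := by
  rw [Kker_eq_indicator, Set.indicator_of_notMem hx]

theorem integrable_Kker_sq : Integrable (fun u => (Kker u) ^ 2) := by
  refine (contDiff_one_Kker.continuous.pow 2).integrable_of_hasCompactSupport
    (HasCompactSupport.intro (isCompact_Icc (a := (-1 : ℝ)) (b := 1)) fun x hx => ?_)
  simp [Kker_eq_zero_of_notMem hx]

/-- The explicit kernel `K` is continuously differentiable, compactly supported in
`[−1,1]`, integrates to `1`, has vanishing moments of orders `1, 2, 3`, is square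
integrable, and `K`, `K'`, `K''` all vanish at the boundary points `±1`. -/
theorem explicit_kernel_properties :
    ContDiff ℝ 1 Kker ∧
    (∀ x : ℝ, x ∉ Set.Icc (-1 : ℝ) 1 → Kker x = 0) ∧
    (∫ u, Kker u) = 1 ∧
    (∀ j : ℕ, 1 ≤ j → j ≤ 3 → (∫ u, u ^ j * Kker u) = 0) ∧
    Integrable (fun u => (Kker u) ^ 2) ∧
    Kker (-1) = 0 ∧ Kker 1 = 0 ∧
    deriv Kker (-1) = 0 ∧ deriv Kker 1 = 0 ∧
    deriv (deriv Kker) (-1) = 0 ∧ deriv (deriv Kker) 1 = 0 := by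
  refine ⟨contDiff_one_Kker, fun x hx => Kker_eq_zero_of_notMem hx, integral_Kker, ?_,
    integrable_Kker_sq, ?_, ?_, ?_, ?_, ?_, ?_⟩
  · intro j h1 h3
    interval_cases j
    · exact integral_odd_pow_mul_Kker (by decide)
    · exact integral_sq_mul_Kker
    · exact integral_odd_pow_mul_Kker (by decide)
  · norm_num [Kker_eq_indicator, kerPoly]
  · norm_num [Kker_eq_indicator, kerPoly]
  · norm_num [deriv_Kker, kerPolyDeriv]
  · norm_num [deriv_Kker, kerPolyDeriv]
  · norm_num [(hasDerivAt_deriv_Kker _).deriv, kerPolyDeriv₂]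
  · norm_num [(hasDerivAt_deriv_Kker _).deriv, kerPolyDeriv₂]
end

section
/- Any minimizer φ̂ of θ ↦ ‖Â(θ)‖ over Θ (i.e. any φ̂ ∈ Θ with ‖Â(φ̂)‖ ≤ ‖Â(θ)‖ for all θ ∈ Θ) satisfies d(φ̂, φ) ≤ 2·c·ε. (This is the deterministic rate argument underlying Lemma A.6 of the paper: combining argmin stability with local coercivity yields that the estimation error of φ̂ is controlled by the uniform error ε of the estimated criterion.) -/
/-- A minimizer of a uniform `ε`-perturbation of `‖A ·‖` is a `2ε`-approximate zero of `A`. -/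
theorem norm_le_two_mul_of_approx_argmin
    {Θ Y : Type*} [SeminormedAddCommGroup Y] {A Ahat : Θ → Y} {φ φhat : Θ} {ε : ℝ}
    (hAφ : A φ = 0) (happrox : ∀ θ, ‖Ahat θ - A θ‖ ≤ ε)
    (hmin : ∀ θ, ‖Ahat φhat‖ ≤ ‖Ahat θ‖) : ‖A φhat‖ ≤ 2 * ε := by
  have hφ : ‖Ahat φ‖ ≤ ε := by simpa [hAφ] using happrox φ
  have htri := norm_le_norm_add_norm_sub (Ahat φhat) (A φhat)
  linarith [happrox φhat, hmin φ]

/-- Deterministic rate for the argmin: combining argmin stability with local coercivity,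
if `A(φ) = 0`, `‖Â − A‖ ≤ ε` uniformly, `‖A(θ)‖ > 2ε` whenever `d(θ,φ) ≥ ς`
(separation), and `d(θ,φ) ≤ c·‖A(θ)‖` whenever `d(θ,φ) ≤ ς` (local coercivity), then
any minimizer `φ̂` of `θ ↦ ‖Â(θ)‖` satisfies `d(φ̂, φ) ≤ 2·c·ε`. -/
theorem argmin_rate
    {Θ : Type*} [MetricSpace Θ] {Y : Type*} [NormedAddCommGroup Y]
    (A Ahat : Θ → Y) (φ : Θ) (hAφ : A φ = 0)
    (ε : ℝ) (hε : 0 ≤ ε)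
    (happrox : ∀ θ, ‖Ahat θ - A θ‖ ≤ ε)
    (ς : ℝ) (hς : 0 < ς)
    (hsep : ∀ θ, ς ≤ dist θ φ → 2 * ε < ‖A θ‖)
    (c : ℝ) (hc : 0 < c)
    (hcoer : ∀ θ, dist θ φ ≤ ς → dist θ φ ≤ c * ‖A θ‖)
    (φhat : Θ) (hmin : ∀ θ, ‖Ahat φhat‖ ≤ ‖Ahat θ‖) :
    dist φhat φ ≤ 2 * c * ε := by
  have hA := norm_le_two_mul_of_approx_argmin hAφ happrox hmin
  have hdist : dist φhat φ ≤ ς := le_of_not_ge fun h => (hsep φhat h).not_ge hA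
  calc dist φhat φ ≤ c * ‖A φhat‖ := hcoer φhat hdist
    _ ≤ c * (2 * ε) := by gcongr
    _ = 2 * c * ε := by ring
end
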